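/- (Theorem 1, second problem: weak duality and primal recovery.) Let N = H₋ᵀH₋ + c₂E₁ with c₂ > 0, which is symmetric positive definite. (i) For every (w, b, ξ) with (X₊w + e₊b) + ξ ≥ e₊ and ξ ≥ 0, and every β ∈ ℝ^{l₊} with 0 ≤ β ≤ c₄s₊, one has ⟨e₊, β⟩ - (1/2)βᵀH₊N⁻¹H₊ᵀβ ≤ (1/2)c₂‖w‖² + (1/2)‖X₋w + e₋b‖² + c₄⟨s₊, ξ⟩. (ii) If β* maximizes the dual objective over the box {0 ≤ β ≤ c₄s₊}, then u₋* = (w₋*, b₋*) = N⁻¹H₊ᵀβ* together with ξ*ᵢ = max(0, 1 - (X₊w₋* + e₊b₋*)ᵢ) is feasible and optimal for this primal problem, with equal optimal values. -/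

import Mathlib

open Matrix

theorem nonpos_of_forall_mul_le_sq_mul {a q : ℝ} (hq : 0 ≤ q)
    (h : ∀ t : ℝ, 0 ≤ t → t ≤ 1 → t * a ≤ t ^ 2 * q) : a ≤ 0 := by
  by_contra! ha
  have hs : 0 < a + q := by linarith
  have h1 := h (a / (a + q)) (by positivity) ((div_le_one hs).2 (by linarith))
  rw [div_pow, div_mul_eq_mul_div, div_mul_eq_mul_div, div_le_div_iff₀ hs (by positivity)] at h1
  have h2 : 0 < a ^ 3 * (a + q) := by positivity
  nlinarith

theorem dotProduct_mulVec_symm {κ : Type*} [Fintype κ] {N : Matrix κ κ ℝ}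
    (hN : N.PosDef) (x y : κ → ℝ) :
    x ⬝ᵥ N *ᵥ y = y ⬝ᵥ N *ᵥ x := by
  have h : Nᵀ = N := by simpa [IsHermitian] using hN.isHermitian
  rw [dotProduct_mulVec, ← mulVec_transpose, h, dotProduct_comm]

section BoxQP

variable {ι κ : Type*} [Fintype ι] [Fintype κ] [DecidableEq κ]

/-- The objective of the concave dual quadratic program attached to `N` and `H`. -/
noncomputable def dualObjective (N : Matrix κ κ ℝ) (H : Matrix ι κ ℝ) (β : ι → ℝ) : ℝ :=
  (fun _ : ι => (1 : ℝ)) ⬝ᵥ β - (1 / 2) * (β ⬝ᵥ (H * N⁻¹ * Hᵀ) *ᵥ β)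

theorem mulVec_inv_mulVec {N : Matrix κ κ ℝ} (hN : N.PosDef) (x : κ → ℝ) :
    N *ᵥ (N⁻¹ *ᵥ x) = x := by
  rw [mulVec_mulVec, mul_nonsing_inv _ ((isUnit_iff_isUnit_det N).1 hN.isUnit), one_mulVec]

theorem dotProduct_gram_mulVec (N : Matrix κ κ ℝ) (H : Matrix ι κ ℝ) (α β : ι → ℝ) :
    α ⬝ᵥ (H * N⁻¹ * Hᵀ) *ᵥ β = α ⬝ᵥ (H *ᵥ (N⁻¹ *ᵥ (Hᵀ *ᵥ β))) := by
  simp only [mulVec_mulVec, Matrix.mul_assoc]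

theorem dotProduct_mulVec_eq {N : Matrix κ κ ℝ} (hN : N.PosDef) (H : Matrix ι κ ℝ)
    (β : ι → ℝ) (u : κ → ℝ) :
    β ⬝ᵥ H *ᵥ u = u ⬝ᵥ N *ᵥ (N⁻¹ *ᵥ (Hᵀ *ᵥ β)) := by
  rw [mulVec_inv_mulVec hN, dotProduct_mulVec, ← mulVec_transpose, dotProduct_comm]

theorem dualObjective_le {N : Matrix κ κ ℝ} (hN : N.PosDef) (H : Matrix ι κ ℝ)
    {C β ξ : ι → ℝ} {u : κ → ℝ} (hu : ∀ i, 1 ≤ (H *ᵥ u) i + ξ i) (hξ : ∀ i, 0 ≤ ξ i)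
    (hβ : ∀ i, 0 ≤ β i ∧ β i ≤ C i) :
    dualObjective N H β ≤ (1 / 2) * (u ⬝ᵥ N *ᵥ u) + C ⬝ᵥ ξ := by
  rw [dualObjective, dotProduct_gram_mulVec, dotProduct_mulVec_eq hN]
  have hβu := dotProduct_mulVec_eq hN H β u
  set v := N⁻¹ *ᵥ (Hᵀ *ᵥ β)
  have hsq : 0 ≤ (u - v) ⬝ᵥ N *ᵥ (u - v) := by
    simpa using hN.posSemidef.dotProduct_mulVec_nonneg (u - v)
  rw [mulVec_sub, sub_dotProduct, dotProduct_sub, dotProduct_sub,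
    dotProduct_mulVec_symm hN v u] at hsq
  have hle : (fun _ : ι => (1 : ℝ)) ⬝ᵥ β ≤ β ⬝ᵥ H *ᵥ u + C ⬝ᵥ ξ := by
    simp only [dotProduct, ← Finset.sum_add_distrib]
    refine Finset.sum_le_sum fun i _ => ?_
    nlinarith [mul_le_mul_of_nonneg_left (hu i) (hβ i).1,
      mul_le_mul_of_nonneg_right (hβ i).2 (hξ i)]
  linarith

theorem dualObjective_add_smul {N : Matrix κ κ ℝ} (hN : N.PosDef) (H : Matrix ι κ ℝ)
    (β d : ι → ℝ) (t : ℝ) :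
    dualObjective N H (β + t • d) = dualObjective N H β
      + t * (d ⬝ᵥ fun i => 1 - (H *ᵥ (N⁻¹ *ᵥ (Hᵀ *ᵥ β))) i)
      - t ^ 2 * ((1 / 2) * (d ⬝ᵥ (H * N⁻¹ * Hᵀ) *ᵥ d)) := by
  have hsymm : β ⬝ᵥ (H * N⁻¹ * Hᵀ) *ᵥ d = d ⬝ᵥ (H * N⁻¹ * Hᵀ) *ᵥ β := by
    rw [dotProduct_gram_mulVec, dotProduct_gram_mulVec, dotProduct_mulVec_eq hN H β,
      dotProduct_mulVec_eq hN H d, dotProduct_mulVec_symm hN]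
  have hg : (d ⬝ᵥ fun i => 1 - (H *ᵥ (N⁻¹ *ᵥ (Hᵀ *ᵥ β))) i)
      = (fun _ : ι => (1 : ℝ)) ⬝ᵥ d - d ⬝ᵥ (H * N⁻¹ * Hᵀ) *ᵥ β := by
    rw [dotProduct_gram_mulVec, dotProduct_comm _ d, ← dotProduct_sub]
    rfl
  rw [hg]
  simp only [dualObjective, mulVec_add, mulVec_smul, dotProduct_add, add_dotProduct,
    smul_dotProduct, dotProduct_smul, smul_eq_mul, hsymm]
  ring

theorem primal_le_dualObjective_of_isMax {N : Matrix κ κ ℝ} (hN : N.PosDef) (H : Matrix ι κ ℝ)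
    {C β : ι → ℝ} (hβ : ∀ i, 0 ≤ β i ∧ β i ≤ C i)
    (hmax : ∀ γ : ι → ℝ, (∀ i, 0 ≤ γ i ∧ γ i ≤ C i) →
      dualObjective N H γ ≤ dualObjective N H β) :
    (1 / 2) * ((N⁻¹ *ᵥ (Hᵀ *ᵥ β)) ⬝ᵥ N *ᵥ (N⁻¹ *ᵥ (Hᵀ *ᵥ β)))
      + C ⬝ᵥ (fun i => max 0 (1 - (H *ᵥ (N⁻¹ *ᵥ (Hᵀ *ᵥ β))) i)) ≤ dualObjective N H β := by
  classical
  set g : ι → ℝ := fun i => 1 - (H *ᵥ (N⁻¹ *ᵥ (Hᵀ *ᵥ β))) i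
  set γ : ι → ℝ := fun i => if 0 < g i then C i else 0 with hγ
  have hγ_box : ∀ i, 0 ≤ γ i ∧ γ i ≤ C i := fun i => by
    have := (hβ i).1.trans (hβ i).2
    simp only [hγ]
    split_ifs <;> simp [this]
  have hfirst : (γ - β) ⬝ᵥ g ≤ 0 := by
    refine nonpos_of_forall_mul_le_sq_mul
      (q := (1 / 2) * ((γ - β) ⬝ᵥ (H * N⁻¹ * Hᵀ) *ᵥ (γ - β))) ?_ fun t ht0 ht1 => ?_
    · rw [dotProduct_gram_mulVec, dotProduct_mulVec_eq hN]
      have := hN.posSemidef.dotProduct_mulVec_nonneg (N⁻¹ *ᵥ (Hᵀ *ᵥ (γ - β)))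
      rw [star_trivial] at this
      linarith
    · have hle := hmax (β + t • (γ - β)) fun i => by
        simp only [Pi.add_apply, Pi.smul_apply, Pi.sub_apply, smul_eq_mul]
        constructor
        · nlinarith [mul_nonneg ht0 (hγ_box i).1, mul_nonneg (sub_nonneg.2 ht1) (hβ i).1]
        · nlinarith [mul_le_mul_of_nonneg_left (hγ_box i).2 ht0,
            mul_le_mul_of_nonneg_left (hβ i).2 (sub_nonneg.2 ht1)]
      rw [dualObjective_add_smul hN] at hle
      linarith
  have hγg : γ ⬝ᵥ g = C ⬝ᵥ fun i => max 0 (g i) := by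
    refine Finset.sum_congr rfl fun i _ => ?_
    simp only [hγ]
    split_ifs with h
    · rw [max_eq_right h.le]
    · rw [max_eq_left (not_lt.1 h), zero_mul, mul_zero]
  have hβg : β ⬝ᵥ g = (fun _ : ι => (1 : ℝ)) ⬝ᵥ β - β ⬝ᵥ H *ᵥ (N⁻¹ *ᵥ (Hᵀ *ᵥ β)) := by
    rw [dotProduct_comm _ β, ← dotProduct_sub]
    rfl
  rw [sub_dotProduct, hγg, hβg, dotProduct_mulVec_eq hN] at hfirst
  rw [dualObjective, dotProduct_gram_mulVec, dotProduct_mulVec_eq hN H β]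
  linarith

end BoxQP

theorem of_snoc_one_mulVec {m n : ℕ} (X : Matrix (Fin m) (Fin n) ℝ) (u : Fin (n + 1) → ℝ) :
    (Matrix.of fun i => (Fin.snoc (X i) 1 : Fin (n + 1) → ℝ)) *ᵥ u
      = X *ᵥ (Fin.init u : Fin n → ℝ) + u (Fin.last n) • (fun _ : Fin m => (1 : ℝ)) := by
  ext i
  simp [mulVec, dotProduct, Fin.sum_univ_castSucc, Fin.init]

theorem dotProduct_regularizedGram_mulVec {m n : ℕ} (X : Matrix (Fin m) (Fin n) ℝ) (c : ℝ)
    (H : Matrix (Fin m) (Fin (n + 1)) ℝ)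
    (hH : H = Matrix.of fun i => (Fin.snoc (X i) 1 : Fin (n + 1) → ℝ))
    (u : Fin (n + 1) → ℝ) :
    u ⬝ᵥ (Hᵀ * H + c • Matrix.diagonal (Fin.snoc (fun _ : Fin n => (1 : ℝ)) 0)) *ᵥ u
      = c * ((Fin.init u : Fin n → ℝ) ⬝ᵥ (Fin.init u : Fin n → ℝ))
        + (X *ᵥ (Fin.init u : Fin n → ℝ) + u (Fin.last n) • (fun _ : Fin m => (1 : ℝ)))
          ⬝ᵥ (X *ᵥ (Fin.init u : Fin n → ℝ) + u (Fin.last n) • (fun _ : Fin m => (1 : ℝ))) := by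
  rw [← of_snoc_one_mulVec, ← hH, add_mulVec, dotProduct_add, ← mulVec_mulVec,
    dotProduct_mulVec u Hᵀ, vecMul_transpose, smul_mulVec, dotProduct_smul, smul_eq_mul, add_comm]
  congr 2
  simp [mulVec_diagonal, dotProduct, Fin.sum_univ_castSucc, Fin.init]

theorem posDef_regularizedGram {m n : ℕ} (hm : 1 ≤ m) (X : Matrix (Fin m) (Fin n) ℝ) {c : ℝ}
    (hc : 0 < c) (H : Matrix (Fin m) (Fin (n + 1)) ℝ)
    (hH : H = Matrix.of fun i => (Fin.snoc (X i) 1 : Fin (n + 1) → ℝ)) :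
    (Hᵀ * H + c • Matrix.diagonal (Fin.snoc (fun _ : Fin n => (1 : ℝ)) 0)).PosDef := by
  refine PosDef.of_dotProduct_mulVec_pos ?_ fun u hu => ?_
  · simp [IsHermitian, transpose_mul]
  · rw [star_trivial, dotProduct_regularizedGram_mulVec X c H hH]
    have hsq {k : ℕ} (x : Fin k → ℝ) : 0 ≤ x ⬝ᵥ x := by
      simpa using dotProduct_star_self_nonneg x
    by_cases hw : (Fin.init u : Fin n → ℝ) = 0
    · have hb : u (Fin.last n) ≠ 0 := fun hb => hu <| by
        ext i
        refine Fin.lastCases hb (fun j => ?_) i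
        exact congrFun hw j
      have hm' : (0 : ℝ) < m := by exact_mod_cast hm
      simp only [hw, mulVec_zero, zero_add, dotProduct_zero, mul_zero, smul_dotProduct,
        dotProduct_smul, smul_eq_mul]
      simp only [dotProduct, mul_one, Finset.sum_const, Finset.card_univ, Fintype.card_fin,
        nsmul_eq_mul]
      rw [← mul_assoc]
      exact mul_pos (mul_self_pos.2 hb) hm'
    · have hpos : 0 < (Fin.init u : Fin n → ℝ) ⬝ᵥ (Fin.init u : Fin n → ℝ) :=
        (hsq _).lt_of_ne' fun h => hw (dotProduct_self_eq_zero.1 h)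
      exact add_pos_of_pos_of_nonneg (mul_pos hc hpos) (hsq _)

/-- Theorem 1, second problem: `N = H₋ᵀH₋ + c₂E₁` is symmetric positive definite;
(i) weak duality holds between the second FR-TSVM primal problem and its dual;
(ii) if `β*` maximizes the dual objective over the box `0 ≤ β ≤ c₄s₊`, then
`u₋* = (w₋*, b₋*) = N⁻¹H₊ᵀβ*` together with `ξ*ᵢ = max(0, 1 - (X₊w₋* + e₊b₋*)ᵢ)` is feasible
and optimal for the primal problem, with equal optimal values. -/
theorem frtsvm_second_problem {n lp lm : ℕ} (hlp : 1 ≤ lp) (hlm : 1 ≤ lm)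
    (Xp : Matrix (Fin lp) (Fin n) ℝ) (Xm : Matrix (Fin lm) (Fin n) ℝ)
    (c₂ c₄ : ℝ) (hc₂ : 0 < c₂) (hc₄ : 0 < c₄)
    (s : Fin lp → ℝ) (hs : ∀ i, 0 < s i) :
    let Hp : Matrix (Fin lp) (Fin (n + 1)) ℝ := Matrix.of fun i => Fin.snoc (Xp i) 1
    let Hm : Matrix (Fin lm) (Fin (n + 1)) ℝ := Matrix.of fun i => Fin.snoc (Xm i) 1
    let E₁ : Matrix (Fin (n + 1)) (Fin (n + 1)) ℝ :=
      Matrix.diagonal (Fin.snoc (fun _ : Fin n => (1 : ℝ)) 0)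
    let N := Hmᵀ * Hm + c₂ • E₁
    let dual : (Fin lp → ℝ) → ℝ := fun β =>
      (fun _ : Fin lp => (1 : ℝ)) ⬝ᵥ β - (1 / 2) * (β ⬝ᵥ (Hp * N⁻¹ * Hpᵀ) *ᵥ β)
    let primal : (Fin n → ℝ) → ℝ → (Fin lp → ℝ) → ℝ := fun w b ξ =>
      (1 / 2) * c₂ * (w ⬝ᵥ w)
        + (1 / 2) * ((Xm *ᵥ w + b • (fun _ : Fin lm => (1 : ℝ)))
            ⬝ᵥ (Xm *ᵥ w + b • (fun _ : Fin lm => (1 : ℝ))))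
        + c₄ * (s ⬝ᵥ ξ)
    N.PosDef ∧
    (∀ (w : Fin n → ℝ) (b : ℝ) (ξ : Fin lp → ℝ),
        (∀ i, (Xp *ᵥ w) i + b + ξ i ≥ 1) → (∀ i, 0 ≤ ξ i) →
        ∀ β : Fin lp → ℝ, (∀ i, 0 ≤ β i ∧ β i ≤ c₄ * s i) →
        dual β ≤ primal w b ξ) ∧
    (∀ βs : Fin lp → ℝ,
      (∀ i, 0 ≤ βs i ∧ βs i ≤ c₄ * s i) →
      (∀ β : Fin lp → ℝ, (∀ i, 0 ≤ β i ∧ β i ≤ c₄ * s i) → dual β ≤ dual βs) →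
      let ustar : Fin (n + 1) → ℝ := N⁻¹ *ᵥ (Hpᵀ *ᵥ βs)
      let wstar : Fin n → ℝ := Fin.init ustar
      let bstar : ℝ := ustar (Fin.last n)
      let ξstar : Fin lp → ℝ := fun i => max 0 (1 - ((Xp *ᵥ wstar) i + bstar))
      (∀ i, (Xp *ᵥ wstar) i + bstar + ξstar i ≥ 1 ∧ 0 ≤ ξstar i) ∧
      (∀ (w : Fin n → ℝ) (b : ℝ) (ξ : Fin lp → ℝ),
          (∀ i, (Xp *ᵥ w) i + b + ξ i ≥ 1 ∧ 0 ≤ ξ i) →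
          primal wstar bstar ξstar ≤ primal w b ξ) ∧
      primal wstar bstar ξstar = dual βs) := by
  intro Hp Hm E₁ N dual primal
  have hN : N.PosDef := posDef_regularizedGram hlm Xm hc₂ Hm rfl
  have hHp (u : Fin (n + 1) → ℝ) (i : Fin lp) :
      (Hp *ᵥ u) i = (Xp *ᵥ (Fin.init u : Fin n → ℝ)) i + u (Fin.last n) := by
    simp [Hp, of_snoc_one_mulVec]
  have hprimal (u : Fin (n + 1) → ℝ) (ξ : Fin lp → ℝ) :
      primal (Fin.init u) (u (Fin.last n)) ξ
        = (1 / 2) * (u ⬝ᵥ N *ᵥ u) + (fun i => c₄ * s i) ⬝ᵥ ξ := by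
    have hC : (fun i => c₄ * s i) ⬝ᵥ ξ = c₄ * (s ⬝ᵥ ξ) := smul_dotProduct c₄ s ξ
    rw [hC, dotProduct_regularizedGram_mulVec Xm c₂ Hm rfl]
    simp only [primal]
    ring
  have hweak (w : Fin n → ℝ) (b : ℝ) (ξ : Fin lp → ℝ)
      (hfeas : ∀ i, (Xp *ᵥ w) i + b + ξ i ≥ 1) (hξ : ∀ i, 0 ≤ ξ i)
      (β : Fin lp → ℝ) (hβ : ∀ i, 0 ≤ β i ∧ β i ≤ c₄ * s i) : dual β ≤ primal w b ξ := by
    have hp := hprimal (Fin.snoc w b) ξ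
    rw [Fin.init_snoc, Fin.snoc_last] at hp
    rw [hp]
    refine dualObjective_le hN Hp (fun i => ?_) hξ hβ
    rw [hHp, Fin.init_snoc, Fin.snoc_last]
    exact hfeas i
  refine ⟨hN, hweak, ?_⟩
  intro βs hβs hmax ustar wstar bstar ξstar
  have hfeas : ∀ i, (Xp *ᵥ wstar) i + bstar + ξstar i ≥ 1 ∧ 0 ≤ ξstar i := fun i =>
    ⟨by linarith [le_max_right 0 (1 - ((Xp *ᵥ wstar) i + bstar))], le_max_left _ _⟩
  have hle : primal wstar bstar ξstar ≤ dual βs := by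
    have h := primal_le_dualObjective_of_isMax hN Hp hβs hmax
    simp only [hHp] at h
    exact (hprimal ustar ξstar).trans_le h
  exact ⟨hfeas,
    fun w b ξ h => hle.trans (hweak w b ξ (fun i => (h i).1) (fun i => (h i).2) βs hβs),
    hle.antisymm (hweak _ _ _ (fun i => (hfeas i).1) (fun i => (hfeas i).2) βs hβs)⟩
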